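/- Let α > 1, ε > 0, Δ ≥ 0, a > 0, b > 0, and set A = (1−α)a + αb. Assume A > 0 and g(0) > ε. Then there exists a unique z* > 0 with g(z*) = ε, and moreover for every z ≥ 0 one has g(z) ≤ ε if and only if z ≥ z*. -/

import Mathlib

/-- The privacy loss function: for `α > 1`, `Δ ≥ 0`, `a > 0`, `b > 0`, with
`A = (1−α)a + αb`, `g(z) = αΔ/(2(z+A)) + (1/(2(1−α))) ln((z+A)/((z+a)^{1−α}(z+b)^α))`. -/
noncomputable def privacyLoss (α Δ a b z : ℝ) : ℝ :=
  α * Δ / (2 * (z + ((1 - α) * a + α * b)))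
    + (1 / (2 * (1 - α))) * Real.log ((z + ((1 - α) * a + α * b))
        / ((z + a) ^ (1 - α) * (z + b) ^ α))

open Filter Topology Set

theorem privacyLoss_eq_of_pos {α Δ a b z : ℝ} (ha : 0 < z + a) (hb : 0 < z + b)
    (hA : 0 < z + ((1 - α) * a + α * b)) :
    privacyLoss α Δ a b z = α * Δ / (2 * (z + ((1 - α) * a + α * b)))
      + (1 / (2 * (1 - α))) * (Real.log (z + ((1 - α) * a + α * b))
        - ((1 - α) * Real.log (z + a) + α * Real.log (z + b))) := by
  have h₁ := Real.rpow_pos_of_pos ha (1 - α)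
  have h₂ := Real.rpow_pos_of_pos hb α
  rw [privacyLoss, Real.log_div hA.ne' (mul_pos h₁ h₂).ne', Real.log_mul h₁.ne' h₂.ne',
    Real.log_rpow ha, Real.log_rpow hb]

theorem hasDerivAt_privacyLoss {α Δ a b z : ℝ} (hα : α ≠ 1) (ha : 0 < z + a) (hb : 0 < z + b)
    (hA : 0 < z + ((1 - α) * a + α * b)) :
    HasDerivAt (privacyLoss α Δ a b)
      (-(α / (2 * (z + ((1 - α) * a + α * b))) *
        (Δ / (z + ((1 - α) * a + α * b)) + (a - b) ^ 2 / ((z + a) * (z + b))))) z := by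
  have hα' : 1 - α ≠ 0 := sub_ne_zero.mpr hα.symm
  have add_const (c : ℝ) : HasDerivAt (fun x : ℝ => x + c) 1 z := (hasDerivAt_id z).add_const c
  have key := ((hasDerivAt_const z (α * Δ)).div
    ((add_const ((1 - α) * a + α * b)).const_mul 2) (by positivity)).add
    ((((add_const ((1 - α) * a + α * b)).log hA.ne').sub
      ((((add_const a).log ha.ne').const_mul (1 - α)).add
        (((add_const b).log hb.ne').const_mul α))).const_mul (1 / (2 * (1 - α))))
  have pos {c : ℝ} (hc : 0 < z + c) : ∀ᶠ x in 𝓝 z, 0 < x + c :=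
    (add_const c).continuousAt.eventually (lt_mem_nhds hc)
  refine (key.congr_of_eventuallyEq ?_).congr_deriv ?_
  · filter_upwards [pos ha, pos hb, pos hA] with x hxa hxb hxA
    exact privacyLoss_eq_of_pos hxa hxb hxA
  have := ha.ne'
  have := hb.ne'
  have := hA.ne'
  generalize hw : z + ((1 - α) * a + α * b) = w at *
  field_simp
  rw [← hw]
  ring

theorem tendsto_privacyLoss_atTop (α Δ a b : ℝ) :
    Tendsto (privacyLoss α Δ a b) atTop (𝓝 0) := by
  have hlog := Real.tendsto_log_comp_add_sub_log
  have hfrac : Tendsto (fun z : ℝ => α * Δ / (2 * (z + ((1 - α) * a + α * b)))) atTop (𝓝 0) :=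
    ((tendsto_atTop_add_const_right atTop _ tendsto_id).const_mul_atTop two_pos).const_div_atTop _
  have key := hfrac.add (((hlog ((1 - α) * a + α * b)).sub
    (((hlog a).const_mul (1 - α)).add ((hlog b).const_mul α))).const_mul (1 / (2 * (1 - α))))
  simp only [mul_zero, add_zero, sub_zero] at key
  refine key.congr' ?_
  have pos (c : ℝ) : ∀ᶠ z : ℝ in atTop, 0 < z + c :=
    (tendsto_atTop_add_const_right atTop c tendsto_id).eventually_gt_atTop 0
  filter_upwards [pos a, pos b, pos ((1 - α) * a + α * b)] with z hza hzb hzA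
  rw [privacyLoss_eq_of_pos hza hzb hzA]
  ring

theorem privacyLoss_zero_self (α : ℝ) {a z : ℝ} (ha : 0 < z + a) : privacyLoss α 0 a a z = 0 := by
  have h : z + ((1 - α) * a + α * a) = z + a := by ring
  rw [privacyLoss_eq_of_pos ha ha (h ▸ ha), h]
  ring

theorem strictAntiOn_privacyLoss {α Δ a b : ℝ} (hα : 1 < α) (hΔ : 0 ≤ Δ) (ha : 0 < a) (hb : 0 < b)
    (hA : 0 < (1 - α) * a + α * b) (hne : Δ ≠ 0 ∨ a ≠ b) :
    StrictAntiOn (privacyLoss α Δ a b) (Ici 0) := by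
  have deriv_at {z : ℝ} (hz : 0 ≤ z) := hasDerivAt_privacyLoss (Δ := Δ) hα.ne'
    (add_pos_of_nonneg_of_pos hz ha) (add_pos_of_nonneg_of_pos hz hb)
    (add_pos_of_nonneg_of_pos hz hA)
  refine strictAntiOn_of_deriv_neg (convex_Ici 0)
    (fun z hz => (deriv_at hz).continuousAt.continuousWithinAt) fun z hz => ?_
  rw [interior_Ici, mem_Ioi] at hz
  rw [(deriv_at hz.le).deriv, neg_lt_zero]
  have hw := add_pos hz hA
  refine mul_pos (by positivity) ?_
  rcases hne with h | h
  · have : 0 < Δ := hΔ.lt_of_ne' h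
    positivity
  · have : a - b ≠ 0 := sub_ne_zero.mpr h
    positivity

theorem stmt_6 (α ε Δ a b : ℝ) (hα : 1 < α) (hε : 0 < ε) (hΔ : 0 ≤ Δ)
    (ha : 0 < a) (hb : 0 < b) (hA : 0 < (1 - α) * a + α * b)
    (hg0 : ε < privacyLoss α Δ a b 0) :
    ∃ zstar : ℝ, 0 < zstar ∧ privacyLoss α Δ a b zstar = ε
      ∧ (∀ z : ℝ, 0 < z → privacyLoss α Δ a b z = ε → z = zstar)
      ∧ ∀ z : ℝ, 0 ≤ z → (privacyLoss α Δ a b z ≤ ε ↔ zstar ≤ z) := by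
  have hne : Δ ≠ 0 ∨ a ≠ b := by
    by_contra! h
    obtain ⟨rfl, rfl⟩ := h
    rw [privacyLoss_zero_self α (by simpa using ha)] at hg0
    exact hε.not_gt hg0
  have hanti := strictAntiOn_privacyLoss hα hΔ ha hb hA hne
  have hcont : ContinuousOn (privacyLoss α Δ a b) (Ici 0) := fun z hz =>
    (hasDerivAt_privacyLoss hα.ne' (add_pos_of_nonneg_of_pos hz ha)
      (add_pos_of_nonneg_of_pos hz hb)
      (add_pos_of_nonneg_of_pos hz hA)).continuousAt.continuousWithinAt
  obtain ⟨M, hMε, hM⟩ := (((tendsto_privacyLoss_atTop α Δ a b).eventually (gt_mem_nhds hε)).and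
    (eventually_ge_atTop 0)).exists
  obtain ⟨zstar, hz, rfl⟩ := intermediate_value_Icc' hM (hcont.mono Icc_subset_Ici_self)
    ⟨hMε.le, hg0.le⟩
  have hz0 : 0 ≤ zstar := hz.1
  refine ⟨zstar, hz0.lt_of_ne fun h => hg0.ne (by rw [← h]), rfl,
    fun z hz' h => hanti.injOn hz'.le hz0 h, fun z hz' => hanti.le_iff_ge hz' hz0⟩
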